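/- Let H be a hyperplane supporting a convex body C in ℍ^d, and let J be a hyperplane supporting C that is ultraparallel to H and at maximal distance from H among all such supporting hyperplanes. Then J ∩ C consists of exactly one point. -/

import Mathlib

noncomputable section

namespace HypSpace

/-- Inverse hyperbolic cosine. -/
def arcosh (x : ℝ) : ℝ := Real.log (x + Real.sqrt (x ^ 2 - 1))

/-- The Minkowski bilinear form on `ℝ^{d+1}` (signature `(d,1)`, the last
coordinate being timelike). -/
def mink (d : ℕ) (x y : EuclideanSpace ℝ (Fin (d + 1))) : ℝ :=
  (∑ i : Fin d, x i.castSucc * y i.castSucc) - x (Fin.last d) * y (Fin.last d)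

/-- The hyperboloid model of `d`-dimensional hyperbolic space: the upper sheet
of the two-sheeted hyperboloid `mink x x = -1`. -/
def Pt (d : ℕ) : Type := {x : EuclideanSpace ℝ (Fin (d + 1)) // mink d x x = -1 ∧ 0 < x (Fin.last d)}

variable {d : ℕ}

/-- Hyperbolic distance between two points of `ℍ^d`. -/
def hdist (p q : Pt d) : ℝ := arcosh (-(mink d p.1 q.1))

/-- The geodesic segment between `a` and `b`, described metrically via betweenness
(hyperbolic space is uniquely geodesic). -/
def seg (a b : Pt d) : Set (Pt d) := {p | hdist a p + hdist p b = hdist a b}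

/-- A set is (geodesically) convex if it contains the segment between any two of its points. -/
def IsConvexSet (C : Set (Pt d)) : Prop := ∀ a ∈ C, ∀ b ∈ C, seg a b ⊆ C

/-- The convex hull: the smallest convex set containing `A`. -/
def chull (A : Set (Pt d)) : Set (Pt d) := ⋂₀ {C | IsConvexSet C ∧ A ⊆ C}

/-- The totally geodesic hyperplane with (spacelike) normal vector `v`. -/
def plane (v : EuclideanSpace ℝ (Fin (d + 1))) : Set (Pt d) := {p | mink d v p.1 = 0}

/-- A hyperplane of `ℍ^d`: the trace on the hyperboloid of a linear hyperplane
with spacelike unit normal. -/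
def IsHyperplane (H : Set (Pt d)) : Prop := ∃ v, mink d v v = 1 ∧ H = plane v

/-- Distance from a point to a set. -/
def distPS (p : Pt d) (S : Set (Pt d)) : ℝ := sInf (hdist p '' S)

/-- Distance between two sets. -/
def distSS (A B : Set (Pt d)) : ℝ := sInf {r | ∃ a ∈ A, ∃ b ∈ B, hdist a b = r}

/-- `h` is the orthogonal projection of `g` onto `H`: the point of `H`
realizing the distance from `g` to `H`.  For a hyperplane `H` with `a ∈ H`,
`IsProj b H a` also expresses that `H` is orthogonal to the segment `ab` at `a`. -/
def IsProj (g : Pt d) (H : Set (Pt d)) (h : Pt d) : Prop :=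
  h ∈ H ∧ ∀ k ∈ H, hdist g h ≤ hdist g k

/-- Two hyperplanes are ultraparallel if they are disjoint and not asymptotically
parallel (their distance is positive, i.e. they admit a common perpendicular). -/
def Ultraparallel (H J : Set (Pt d)) : Prop :=
  IsHyperplane H ∧ IsHyperplane J ∧ H ∩ J = ∅ ∧ 0 < distSS H J

/-- `p` is an interior point of `C`. -/
def IsIntr (C : Set (Pt d)) (p : Pt d) : Prop := ∃ ε > 0, ∀ q, hdist p q < ε → q ∈ C

/-- `p` is a boundary point of the (closed) set `C`. -/
def IsBdry (C : Set (Pt d)) (p : Pt d) : Prop := p ∈ C ∧ ¬ IsIntr C p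

/-- `C` is bounded. -/
def IsBddSet (C : Set (Pt d)) : Prop := ∃ R, ∀ a ∈ C, ∀ b ∈ C, hdist a b ≤ R

/-- `C` is closed. -/
def IsClosedSet (C : Set (Pt d)) : Prop :=
  ∀ p : Pt d, (∀ ε > 0, ∃ q ∈ C, hdist p q < ε) → p ∈ C

/-- A convex body: a compact (closed and bounded) convex set with nonempty interior. -/
def IsBody (C : Set (Pt d)) : Prop :=
  IsConvexSet C ∧ IsBddSet C ∧ IsClosedSet C ∧ ∃ p, IsIntr C p

/-- The hyperplane `H` supports `C`: it meets `C` but misses its interior. -/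
def Supports (H C : Set (Pt d)) : Prop :=
  IsHyperplane H ∧ (H ∩ C).Nonempty ∧ ∀ p, IsIntr C p → p ∉ H

/-- The width of `C` determined by `H`, as the maximum distance from `H`
to a point of `C`. -/
def width (H C : Set (Pt d)) : ℝ := sSup ((fun c => distPS c H) '' C)

/-- The width of `C` determined by `H`, as the distance from `H` to a farthest
supporting hyperplane of `C` ultraparallel to `H`. -/
def widthUP (H C : Set (Pt d)) : ℝ :=
  sSup {r | ∃ J, Supports J C ∧ Ultraparallel H J ∧ distSS H J = r}

/-- The thickness of `C`: the minimum width over supporting hyperplanes. -/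
def thickness (C : Set (Pt d)) : ℝ := sInf {r | ∃ H, Supports H C ∧ width H C = r}

/-- The diameter of `C`. -/
def diam (C : Set (Pt d)) : ℝ := sSup {r | ∃ a ∈ C, ∃ b ∈ C, hdist a b = r}

/-- A body of constant width `δ`. -/
def ConstWidth (W : Set (Pt d)) (δ : ℝ) : Prop :=
  IsBody W ∧ ∀ H, Supports H W → width H W = δ

/-- A complete set of diameter `δ`. -/
def CompleteSet (C : Set (Pt d)) (δ : ℝ) : Prop :=
  diam C = δ ∧ ∀ x, x ∉ C → diam (C ∪ {x}) > δ

/-- A body of constant diameter `δ`. -/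
def ConstDiam (C : Set (Pt d)) (δ : ℝ) : Prop :=
  diam C = δ ∧ ∀ p, IsBdry C p → ∃ p' ∈ C, hdist p p' = δ


/-! ### Minkowski form algebra -/

abbrev EE (d : ℕ) := EuclideanSpace ℝ (Fin (d + 1))

lemma mink_comm (x y : EE d) : mink d x y = mink d y x := by
  simp only [mink]
  congr 1
  · exact Finset.sum_congr rfl (fun i _ => mul_comm _ _)
  · exact mul_comm _ _

lemma mink_add_left (x y z : EE d) : mink d (x + y) z = mink d x z + mink d y z := by
  simp only [mink, PiLp.add_apply, add_mul, Finset.sum_add_distrib]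
  ring

lemma mink_smul_left (c : ℝ) (x z : EE d) : mink d (c • x) z = c * mink d x z := by
  simp only [mink, PiLp.smul_apply, smul_eq_mul, mul_assoc, ← Finset.mul_sum]
  ring

lemma mink_add_right (x y z : EE d) : mink d z (x + y) = mink d z x + mink d z y := by
  rw [mink_comm, mink_add_left, mink_comm x, mink_comm y]

lemma mink_smul_right (c : ℝ) (x z : EE d) : mink d z (c • x) = c * mink d z x := by
  rw [mink_comm, mink_smul_left, mink_comm x]

lemma mink_neg_left (x z : EE d) : mink d (-x) z = - mink d x z := by
  rw [← neg_one_smul ℝ x, mink_smul_left]; ring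

lemma mink_neg_right (x z : EE d) : mink d z (-x) = - mink d z x := by
  rw [mink_comm, mink_neg_left, mink_comm x]

lemma mink_sub_left (x y z : EE d) : mink d (x - y) z = mink d x z - mink d y z := by
  rw [sub_eq_add_neg, mink_add_left, mink_neg_left]; ring

lemma mink_sub_right (x y z : EE d) : mink d z (x - y) = mink d z x - mink d z y := by
  rw [sub_eq_add_neg, mink_add_right, mink_neg_right]; ring

lemma continuous_mink : Continuous (fun q : EE d × EE d => mink d q.1 q.2) := by
  unfold mink
  fun_prop

lemma mink_cont {X : Type*} [TopologicalSpace X] {f g : X → EE d} (hf : Continuous f)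
    (hg : Continuous g) : Continuous (fun x => mink d (f x) (g x)) :=
  continuous_mink.comp (hf.prodMk hg)

lemma norm_sq_eq (x : EE d) :
    ‖x‖ ^ 2 = (∑ i : Fin d, x i.castSucc ^ 2) + x (Fin.last d) ^ 2 := by
  rw [EuclideanSpace.norm_sq_eq, Fin.sum_univ_castSucc]
  simp

lemma mink_self (x : EE d) :
    mink d x x = (∑ i : Fin d, x i.castSucc ^ 2) - x (Fin.last d) ^ 2 := by
  simp only [mink, pow_two]

lemma pt_neg (p q : Pt d) : mink d p.1 q.1 < 0 := by
  obtain ⟨p, hp, hp0⟩ := p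
  obtain ⟨q, hq, hq0⟩ := q
  have h := Finset.sum_mul_sq_le_sq_mul_sq Finset.univ (fun i : Fin d => p i.castSucc)
    (fun i : Fin d => q i.castSucc)
  rw [mink_self] at hp hq
  simp only [mink]
  have h1 : (∑ i : Fin d, p i.castSucc ^ 2) = p (Fin.last d) ^ 2 - 1 := by linarith
  have h2 : (∑ i : Fin d, q i.castSucc ^ 2) = q (Fin.last d) ^ 2 - 1 := by linarith
  have h3 : 0 ≤ (∑ i : Fin d, p i.castSucc ^ 2) := Finset.sum_nonneg (fun i _ => sq_nonneg _)
  have h4 : 0 ≤ (∑ i : Fin d, q i.castSucc ^ 2) := Finset.sum_nonneg (fun i _ => sq_nonneg _)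
  rw [h1, h2] at h
  rw [h1] at h3
  rw [h2] at h4
  have : (∑ i : Fin d, p i.castSucc * q i.castSucc) < p (Fin.last d) * q (Fin.last d) := by
    apply lt_of_pow_lt_pow_left₀ 2 (by positivity)
    nlinarith
  linarith

/-- On the orthogonal complement of a point the form dominates the Euclidean norm. -/
lemma norm_sq_le_of_orth (p : Pt d) (r : EE d) (h : mink d p.1 r = 0) :
    ‖r‖ ^ 2 ≤ 2 * (p.1 (Fin.last d)) ^ 2 * mink d r r := by
  obtain ⟨p, hp, hp0⟩ := p
  have hc := Finset.sum_mul_sq_le_sq_mul_sq Finset.univ (fun i : Fin d => p i.castSucc)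
    (fun i : Fin d => r i.castSucc)
  rw [mink_self] at hp
  simp only [mink] at h
  rw [norm_sq_eq, mink_self r]
  have h1 : (∑ i : Fin d, p i.castSucc ^ 2) = p (Fin.last d) ^ 2 - 1 := by linarith
  have h2 : (∑ i : Fin d, p i.castSucc * r i.castSucc) = p (Fin.last d) * r (Fin.last d) := by
    linarith
  have h3 : 0 ≤ (∑ i : Fin d, p i.castSucc ^ 2) := Finset.sum_nonneg (fun i _ => sq_nonneg _)
  have h4 : 0 ≤ (∑ i : Fin d, r i.castSucc ^ 2) := Finset.sum_nonneg (fun i _ => sq_nonneg _)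
  rw [h1, h2] at hc
  rw [h1] at h3
  set R := ∑ i : Fin d, r i.castSucc ^ 2
  set a := p (Fin.last d)
  set b := r (Fin.last d)
  show R + b ^ 2 ≤ 2 * a ^ 2 * (R - b ^ 2)
  have h6 : R ≤ a ^ 2 * (R - b ^ 2) := by nlinarith
  have h7 : 0 ≤ R - b ^ 2 := nonneg_of_mul_nonneg_right (h4.trans h6) (by positivity)
  linarith

lemma pt_cs (p : Pt d) (y : EE d) : 0 ≤ mink d y y + mink d p.1 y ^ 2 := by
  have hp := p.2.1
  have h := norm_sq_le_of_orth p (y + mink d p.1 y • p.1) (by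
    rw [mink_add_right, mink_smul_right, hp]; ring)
  have e : mink d (y + mink d p.1 y • p.1) (y + mink d p.1 y • p.1)
      = mink d y y + mink d p.1 y ^ 2 := by
    simp only [mink_add_left, mink_add_right, mink_smul_left, mink_smul_right, hp,
      mink_comm y p.1]
    ring
  rw [e] at h
  have h5 : 0 ≤ 2 * (p.1 (Fin.last d)) ^ 2 * (mink d y y + mink d p.1 y ^ 2) :=
    le_trans (by positivity) h
  have := p.2.2
  exact nonneg_of_mul_nonneg_right h5 (by positivity)

lemma one_le (p q : Pt d) : 1 ≤ -mink d p.1 q.1 := by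
  have h := pt_cs p q.1
  rw [q.2.1] at h
  have := pt_neg p q
  nlinarith

lemma pt_eq_of (p q : Pt d) (h : -mink d p.1 q.1 ≤ 1) : p = q := by
  have h1 := one_le p q
  have h2 : mink d p.1 q.1 = -1 := by linarith
  have h3 := norm_sq_le_of_orth p (q.1 - p.1) (by rw [mink_sub_right, h2, p.2.1]; ring)
  simp only [mink_sub_left, mink_sub_right, h2, mink_comm q.1 p.1, p.2.1, q.2.1] at h3
  have h4 : ‖q.1 - p.1‖ ^ 2 ≤ 0 := by linarith
  have h5 : ‖q.1 - p.1‖ = 0 := by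
    have := norm_nonneg (q.1 - p.1)
    nlinarith
  exact Subtype.ext (sub_eq_zero.1 (norm_eq_zero.1 h5)).symm

/-- Euclidean closeness from closeness in the Minkowski sense. -/
lemma norm_sub_sq_le (p q : Pt d) :
    ‖q.1 - p.1‖ ^ 2 ≤ 2 * ((-mink d p.1 q.1 - 1) ^ 2 * ‖p.1‖ ^ 2 +
      2 * (p.1 (Fin.last d)) ^ 2 * (mink d p.1 q.1 ^ 2 - 1)) := by
  set k := mink d p.1 q.1 with hk
  have h := norm_sq_le_of_orth p (q.1 + k • p.1) (by
    rw [mink_add_right, mink_smul_right, p.2.1]; ring)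
  have e : mink d (q.1 + k • p.1) (q.1 + k • p.1) = k ^ 2 - 1 := by
    simp only [mink_add_left, mink_add_right, mink_smul_left, mink_smul_right, p.2.1, q.2.1,
      mink_comm q.1 p.1, ← hk]
    ring
  rw [e] at h
  have e2 : q.1 - p.1 = (-k - 1) • p.1 + (q.1 + k • p.1) := by module
  have h2 : ‖q.1 - p.1‖ ≤ |-k - 1| * ‖p.1‖ + ‖q.1 + k • p.1‖ := by
    rw [e2]
    refine (norm_add_le _ _).trans ?_
    rw [norm_smul, Real.norm_eq_abs]
  have h3 : ‖q.1 - p.1‖ ^ 2 ≤ (|-k - 1| * ‖p.1‖ + ‖q.1 + k • p.1‖) ^ 2 :=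
    pow_le_pow_left₀ (norm_nonneg _) h2 2
  have h4 : (|-k - 1| * ‖p.1‖) ^ 2 = (-k - 1) ^ 2 * ‖p.1‖ ^ 2 := by
    rw [mul_pow, sq_abs]
  nlinarith [sq_nonneg (|-k - 1| * ‖p.1‖ - ‖q.1 + k • p.1‖)]

lemma last_pos_of (q : Pt d) (y : EE d) (hy : mink d y y < 0) (h : mink d q.1 y ≤ 0) :
    0 < y (Fin.last d) := by
  by_contra hc
  push Not at hc
  have hy' : mink d y y = (∑ i : Fin d, y i.castSucc ^ 2) - y (Fin.last d) ^ 2 := mink_self y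
  have h4 : 0 ≤ (∑ i : Fin d, y i.castSucc ^ 2) := Finset.sum_nonneg (fun i _ => sq_nonneg _)
  have hs : 0 < Real.sqrt (-mink d y y) := Real.sqrt_pos.2 (by linarith)
  have hss : Real.sqrt (-mink d y y) ^ 2 = -mink d y y := Real.sq_sqrt (by linarith)
  have hne : y (Fin.last d) ≠ 0 := by
    intro h0
    rw [h0] at hy'
    nlinarith
  have hlt : y (Fin.last d) < 0 := lt_of_le_of_ne hc hne
  have := pt_neg q ⟨(-(Real.sqrt (-mink d y y))⁻¹) • y, by
    refine ⟨?_, ?_⟩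
    · rw [mink_smul_left, mink_smul_right]
      field_simp
      rw [hss]; ring
    · simp only [PiLp.smul_apply, smul_eq_mul]
      have := inv_pos.2 hs
      nlinarith⟩
  simp only [mink_smul_right] at this
  have := inv_pos.2 hs
  nlinarith

/-- Normalisation of a future timelike vector. -/
lemma exists_pt (q : Pt d) (y : EE d) (hy : mink d y y < 0) (h : mink d q.1 y ≤ 0) :
    ∃ p : Pt d, p.1 = (Real.sqrt (-mink d y y))⁻¹ • y := by
  have hs : 0 < Real.sqrt (-mink d y y) := Real.sqrt_pos.2 (by linarith)
  have hss : Real.sqrt (-mink d y y) ^ 2 = -mink d y y := Real.sq_sqrt (by linarith)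
  refine ⟨⟨_, ?_, ?_⟩, rfl⟩
  · rw [mink_smul_left, mink_smul_right]
    field_simp
    rw [hss]; ring
  · simp only [PiLp.smul_apply, smul_eq_mul]
    have := inv_pos.2 hs
    have := last_pos_of q y hy h
    positivity

/-- A scaled timelike vector (up to sign) is a point. -/
lemma exists_pt' (q : Pt d) (y : EE d) (hy : mink d y y < 0) :
    ∃ p : Pt d, ∃ c : ℝ, c ^ 2 * (-mink d y y) = 1 ∧ p.1 = c • y := by
  have hs : 0 < Real.sqrt (-mink d y y) := Real.sqrt_pos.2 (by linarith)
  have hss : Real.sqrt (-mink d y y) ^ 2 = -mink d y y := Real.sq_sqrt (by linarith)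
  rcases le_total (mink d q.1 y) 0 with h | h
  · obtain ⟨p, hp⟩ := exists_pt q y hy h
    refine ⟨p, _, ?_, hp⟩
    rw [inv_pow, hss]
    exact inv_mul_cancel₀ (by linarith)
  · obtain ⟨p, hp⟩ := exists_pt q (-y) (by simpa [mink_neg_left, mink_neg_right] using hy)
      (by rw [mink_neg_right]; linarith)
    refine ⟨p, -(Real.sqrt (-mink d y y))⁻¹, ?_, ?_⟩
    · rw [neg_sq, inv_pow, hss]
      exact inv_mul_cancel₀ (by linarith)
    · rw [hp]; simp [mink_neg_left, mink_neg_right]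

/-! ### Distance -/

lemma arcosh_eq : (arcosh : ℝ → ℝ) = Real.arcosh := by
  funext x
  simp [arcosh, Real.arcosh]

lemma hdist_eq (p q : Pt d) : hdist p q = Real.arcosh (-(mink d p.1 q.1)) := by
  rw [hdist, arcosh_eq]

lemma hdist_nonneg (p q : Pt d) : 0 ≤ hdist p q := by
  rw [hdist_eq]; exact Real.arcosh_nonneg (one_le p q)

lemma cosh_hdist (p q : Pt d) : Real.cosh (hdist p q) = -mink d p.1 q.1 := by
  rw [hdist_eq]; exact Real.cosh_arcosh (one_le p q)

lemma hdist_lt_iff (p q : Pt d) {e : ℝ} (he : 0 ≤ e) :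
    hdist p q < e ↔ -mink d p.1 q.1 < Real.cosh e := by
  rw [← cosh_hdist, Real.cosh_lt_cosh, abs_of_nonneg he, abs_of_nonneg (hdist_nonneg p q)]

lemma hdist_le_iff (p q : Pt d) {e : ℝ} (he : 0 ≤ e) :
    hdist p q ≤ e ↔ -mink d p.1 q.1 ≤ Real.cosh e := by
  rw [← cosh_hdist, Real.cosh_le_cosh, abs_of_nonneg he, abs_of_nonneg (hdist_nonneg p q)]

lemma mem_seg (a b q : Pt d) (s t : ℝ) (hs : 0 ≤ s) (ht : 0 ≤ t)
    (h : q.1 = s • a.1 + t • b.1) : q ∈ seg a b := by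
  show hdist a q + hdist q b = hdist a b
  have hq := q.2.1
  have haq := cosh_hdist a q
  have hqb := cosh_hdist q b
  have hab := cosh_hdist a b
  have hc := one_le a b
  rw [h] at hq haq hqb
  simp only [mink_add_left, mink_add_right, mink_smul_left, mink_smul_right, a.2.1, b.2.1,
      mink_comm b.1 a.1] at hq haq hqb
  set c := mink d a.1 b.1
  have h1 := Real.cosh_sq (hdist a q)
  have h2 := Real.cosh_sq (hdist q b)
  have p1 : 0 ≤ Real.sinh (hdist a q) := Real.sinh_nonneg_iff.2 (hdist_nonneg _ _)
  have p2 : 0 ≤ Real.sinh (hdist q b) := Real.sinh_nonneg_iff.2 (hdist_nonneg _ _)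
  have hr : 0 ≤ c ^ 2 - 1 := by nlinarith
  have hrs := Real.sq_sqrt hr
  have s1 : Real.sinh (hdist a q) = t * Real.sqrt (c ^ 2 - 1) := by
    rw [← sq_eq_sq₀ p1 (by positivity), mul_pow, hrs]
    rw [haq] at h1
    linear_combination -h1 - hq
  have s2 : Real.sinh (hdist q b) = s * Real.sqrt (c ^ 2 - 1) := by
    rw [← sq_eq_sq₀ p2 (by positivity), mul_pow, hrs]
    rw [hqb] at h2
    linear_combination -h2 - hq
  have h3 : Real.cosh (hdist a q + hdist q b) = Real.cosh (hdist a b) := by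
    rw [Real.cosh_add, s1, s2, haq, hqb, hab]
    linear_combination s * t * hrs + c * hq
  have h4 : |hdist a q + hdist q b| = |hdist a b| :=
    le_antisymm (Real.cosh_le_cosh.1 h3.le) (Real.cosh_le_cosh.1 h3.ge)
  rwa [abs_of_nonneg (hdist_nonneg a b),
    abs_of_nonneg (add_nonneg (hdist_nonneg _ _) (hdist_nonneg _ _))] at h4

/-! ### Topology -/

open Filter Topology in
lemma body_compact (C : Set (Pt d)) (hC : IsBody C) :
    IsCompact ((fun p : Pt d => p.1) '' C) := by
  obtain ⟨-, ⟨R, hR⟩, hcl, p, e0, he0, hp⟩ := hC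
  have hpC : p ∈ C := hp p (by
    rw [hdist_lt_iff p p he0.le, p.2.1, neg_neg]; exact Real.one_lt_cosh.2 he0.ne')
  have hR0 : 0 ≤ R := (hdist_nonneg p p).trans (hR p hpC p hpC)
  apply Metric.isCompact_of_isClosed_isBounded
  · apply IsSeqClosed.isClosed
    intro x y hx hy
    choose q hqC hq using hx
    have h1 : Tendsto (fun n => mink d (x n) (x n)) atTop (𝓝 (mink d y y)) :=
      ((mink_cont continuous_id continuous_id).tendsto y).comp hy
    have h1' : (fun n => mink d (x n) (x n)) = fun _ => (-1 : ℝ) := by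
      funext n; rw [← hq n]; exact (q n).2.1
    rw [h1'] at h1
    have hyy : mink d y y = -1 := tendsto_nhds_unique h1 tendsto_const_nhds
    have h2 : Tendsto (fun n => mink d p.1 (x n)) atTop (𝓝 (mink d p.1 y)) :=
      ((mink_cont continuous_const continuous_id).tendsto y).comp hy
    have h3 : mink d p.1 y ≤ 0 := le_of_tendsto' h2 (fun n => by
      rw [← hq n]; exact (pt_neg p (q n)).le)
    have h4 := last_pos_of p y (by rw [hyy]; norm_num) h3
    refine ⟨⟨y, hyy, h4⟩, ?_, rfl⟩
    apply hcl
    intro e he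
    have h5 : Tendsto (fun n => -mink d y (x n)) atTop (𝓝 (-mink d y y)) :=
      ((mink_cont continuous_const continuous_id).neg.tendsto y).comp hy
    rw [hyy, neg_neg] at h5
    obtain ⟨n, hn⟩ := (h5.eventually (gt_mem_nhds (Real.one_lt_cosh.2 he.ne'))).exists
    refine ⟨q n, hqC n, ?_⟩
    refine (hdist_lt_iff _ _ he.le).2 ?_
    have hqn : (q n).1 = x n := hq n
    show -mink d y (q n).1 < Real.cosh e
    rw [hqn]; exact hn
  · set K := 2 * (Real.cosh R ^ 2 * ‖p.1‖ ^ 2 +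
      2 * (p.1 (Fin.last d)) ^ 2 * (Real.cosh R ^ 2)) with hK
    have hK0 : 0 ≤ K := by positivity
    refine (Metric.isBounded_closedBall (x := p.1) (r := Real.sqrt K)).subset ?_
    rintro _ ⟨q, hq, rfl⟩
    rw [mem_closedBall_iff_norm]
    apply Real.le_sqrt_of_sq_le
    refine (norm_sub_sq_le p q).trans ?_
    have h1 := one_le p q
    have h2 := (hdist_le_iff p q hR0).1 (hR p hpC q hq)
    have h3 : (-mink d p.1 q.1 - 1) ^ 2 ≤ Real.cosh R ^ 2 :=
      pow_le_pow_left₀ (by linarith) (by linarith) 2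
    have h4 : mink d p.1 q.1 ^ 2 - 1 ≤ Real.cosh R ^ 2 := by nlinarith
    rw [hK]
    gcongr

open Filter Topology in
lemma intr_nhds (C : Set (Pt d)) (p : Pt d) (h : IsIntr C p) :
    ∀ᶠ y in 𝓝 p.1, ∃ q ∈ C, ∃ c : ℝ, 0 < c ∧ q.1 = c • y := by
  obtain ⟨e, he, hp⟩ := h
  have c1 : Continuous (fun y : EE d => mink d y y) := mink_cont continuous_id continuous_id
  have c2 : Continuous (fun y : EE d => mink d p.1 y) := mink_cont continuous_const continuous_id
  have e1 : ∀ᶠ y in 𝓝 p.1, mink d y y < 0 :=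
    c1.continuousAt.eventually (gt_mem_nhds (by simp only [p.2.1]; norm_num))
  have e2 : ∀ᶠ y in 𝓝 p.1, mink d p.1 y < 0 :=
    c2.continuousAt.eventually (gt_mem_nhds (by simp only [p.2.1]; norm_num))
  have c3 : ContinuousAt (fun y : EE d => -((Real.sqrt (-mink d y y))⁻¹ * mink d p.1 y)) p.1 := by
    refine ((ContinuousAt.inv₀ ?_ ?_).mul c2.continuousAt).neg
    · exact (Real.continuous_sqrt.comp c1.neg).continuousAt
    · rw [p.2.1]; norm_num
  have e3 : ∀ᶠ y in 𝓝 p.1, -((Real.sqrt (-mink d y y))⁻¹ * mink d p.1 y) < Real.cosh e :=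
    c3.eventually (gt_mem_nhds (by
      simp only [p.2.1]; simpa using he.ne'))
  filter_upwards [e1, e2, e3] with y h1 h2 h3
  obtain ⟨q, hq⟩ := exists_pt p y h1 h2.le
  refine ⟨q, hp q ?_, _, inv_pos.2 (Real.sqrt_pos.2 (by linarith)), hq⟩
  rw [hdist_lt_iff _ _ he.le, hq, mink_smul_right]
  exact h3

open Filter Topology in
lemma intr_of (C : Set (Pt d)) (p : Pt d)
    (h : ∀ᶠ y in 𝓝 p.1, ∀ q : Pt d, q.1 = y → q ∈ C) : IsIntr C p := by
  obtain ⟨ρ, hρ, hb⟩ := Metric.eventually_nhds_iff.1 h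
  have c : Continuous (fun k : ℝ => 2 * ((k - 1) ^ 2 * ‖p.1‖ ^ 2 +
      2 * (p.1 (Fin.last d)) ^ 2 * (k ^ 2 - 1))) := by fun_prop
  have c0 : ContinuousAt (fun x : ℝ => 2 * ((Real.cosh x - 1) ^ 2 * ‖p.1‖ ^ 2 +
      2 * (p.1 (Fin.last d)) ^ 2 * (Real.cosh x ^ 2 - 1))) 0 :=
    (c.comp Real.continuous_cosh).continuousAt
  have e1 : ∀ᶠ x in 𝓝 (0 : ℝ), 2 * ((Real.cosh x - 1) ^ 2 * ‖p.1‖ ^ 2 +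
      2 * (p.1 (Fin.last d)) ^ 2 * (Real.cosh x ^ 2 - 1)) < ρ ^ 2 := by
    refine c0.eventually (gt_mem_nhds ?_)
    have h0 : 0 < ρ ^ 2 := by positivity
    simpa using h0
  obtain ⟨e, he, hb2⟩ := Metric.eventually_nhds_iff.1 e1
  refine ⟨e, he, fun q hq => ?_⟩
  refine hb (y := q.1) ?_ q rfl
  have h2 := hb2 (y := hdist p q) (by
    rw [Real.dist_eq, sub_zero, abs_of_nonneg (hdist_nonneg p q)]; exact hq)
  simp only [cosh_hdist, neg_sq] at h2
  have h3 := (norm_sub_sq_le p q).trans_lt h2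
  rw [dist_eq_norm]
  exact lt_of_pow_lt_pow_left₀ 2 hρ.le h3

open Filter Topology in
lemma intr_combo (C : Set (Pt d)) (hC : IsConvexSet C) (p x m : Pt d) (hp : IsIntr C p)
    (hx : x ∈ C) (s t : ℝ) (hs : 0 < s) (ht : 0 ≤ t) (hm : m.1 = s • p.1 + t • x.1) :
    IsIntr C m := by
  apply intr_of
  have c : Continuous (fun y : EE d => s⁻¹ • (y - t • x.1)) := by fun_prop
  have hc := c.tendsto m.1
  have e : s⁻¹ • (m.1 - t • x.1) = p.1 := by
    rw [hm, add_sub_cancel_right, smul_smul, inv_mul_cancel₀ hs.ne', one_smul]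
  rw [e] at hc
  filter_upwards [hc.eventually (intr_nhds C p hp)] with y hy q hq
  obtain ⟨a, haC, k, hk, ha⟩ := hy
  refine hC a haC x hx (mem_seg a x q (s / k) t (by positivity) ht ?_)
  rw [ha, hq, smul_smul, smul_smul]
  have : s / k * (k * s⁻¹) = 1 := by field_simp
  rw [mul_assoc] at *
  rw [this, one_smul, sub_add_cancel]

lemma side_core (C : Set (Pt d)) (hC : IsConvexSet C) (v : EE d)
    (hv : ∀ p, IsIntr C p → p ∉ plane v) (p : Pt d) (hp : IsIntr C p) (hpv : mink d v p.1 < 0)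
    (x : Pt d) (hx : x ∈ C) : mink d v x.1 ≤ 0 := by
  by_contra hc
  push Not at hc
  set s := mink d v x.1 with hs
  set t := -mink d v p.1 with ht
  have htp : 0 < t := by rw [ht]; linarith
  have hpx := pt_neg p x
  set y := s • p.1 + t • x.1 with hy
  have hst : 0 < s * t := by positivity
  have hyy : mink d y y < 0 := by
    simp only [hy, mink_add_left, mink_add_right, mink_smul_left, mink_smul_right, p.2.1, x.2.1,
      mink_comm x.1 p.1]
    nlinarith
  have hpy : mink d p.1 y ≤ 0 := by
    simp only [hy, mink_add_right, mink_smul_right, p.2.1]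
    nlinarith
  obtain ⟨m, hm⟩ := exists_pt p y hyy hpy
  have hpos : 0 < (Real.sqrt (-mink d y y))⁻¹ := inv_pos.2 (Real.sqrt_pos.2 (by linarith))
  set k := (Real.sqrt (-mink d y y))⁻¹
  refine hv m (intr_combo C hC p x m hp hx (k * s) (k * t) (by positivity) (by positivity) ?_) ?_
  · rw [hm, hy, smul_add, smul_smul, smul_smul]
  · show mink d v m.1 = 0
    rw [hm, mink_smul_right, hy, mink_add_right, mink_smul_right, mink_smul_right, ← hs, ht]
    ring

lemma plane_neg (v : EE d) : plane (-v) = plane v := by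
  ext p
  simp [plane, mink_neg_left]

/-- A supporting hyperplane has an outward normal. -/
lemma exists_normal (C : Set (Pt d)) (hC : IsBody C) (J : Set (Pt d)) (hJ : Supports J C) :
    ∃ v, mink d v v = 1 ∧ J = plane v ∧ ∀ x ∈ C, mink d v x.1 ≤ 0 := by
  obtain ⟨⟨v, hv, rfl⟩, -, hint⟩ := hJ
  obtain ⟨hcv, -, -, p, hp⟩ := hC
  rcases lt_trichotomy (mink d v p.1) 0 with h | h | h
  · exact ⟨v, hv, rfl, side_core C hcv v hint p hp h⟩
  · exact absurd h (hint p hp)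
  · refine ⟨-v, by simp [mink_neg_left, mink_neg_right, hv], (plane_neg v).symm, ?_⟩
    exact side_core C hcv (-v) (by rw [plane_neg]; exact hint) p hp
      (by rw [mink_neg_left]; linarith)

lemma not_intr (C : Set (Pt d)) (n : EE d) (hn : mink d n n = 1)
    (h : ∀ x ∈ C, mink d n x.1 ≤ 0) (p : Pt d) (hp : IsIntr C p) : p ∉ plane n := by
  intro hpn
  have hpn : mink d n p.1 = 0 := hpn
  obtain ⟨e, he, hb⟩ := hp
  have hs : 0 < Real.sinh (e / 2) := Real.sinh_pos_iff.2 (by linarith)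
  have hcs := Real.cosh_sq (e / 2)
  have hc := Real.cosh_pos (e / 2)
  set y := Real.cosh (e / 2) • p.1 + Real.sinh (e / 2) • n with hy
  have hyy : mink d y y = -1 := by
    simp only [hy, mink_add_left, mink_add_right, mink_smul_left, mink_smul_right, p.2.1, hn,
      mink_comm p.1 n, hpn]
    linear_combination -hcs
  have hpy : mink d p.1 y = -Real.cosh (e / 2) := by
    simp only [hy, mink_add_right, mink_smul_right, p.2.1, mink_comm p.1 n, hpn]
    ring
  have hl := last_pos_of p y (by linarith) (by linarith)
  have hq := h _ (hb ⟨y, hyy, hl⟩ (by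
    refine (hdist_lt_iff _ _ he.le).2 ?_
    show -mink d p.1 y < Real.cosh e
    rw [hpy, neg_neg, Real.cosh_lt_cosh, abs_of_pos he, abs_of_pos (by linarith)]
    linarith))
  simp only [hy, mink_add_right, mink_smul_right, hn, hpn] at hq
  linarith

/-! ### Distances between hyperplanes -/

lemma cosh_lower (w v : EE d) (hw : mink d w w = 1) (hv : mink d v v = 1)
    (g : ℝ) (hg : mink d w v = -g) (a b : Pt d) (ha : a ∈ plane w) (hb : b ∈ plane v) :
    g ≤ -mink d a.1 b.1 := by
  have ha : mink d w a.1 = 0 := ha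
  have hb : mink d v b.1 = 0 := hb
  have h1 := pt_cs b (a.1 - mink d v a.1 • v)
  have h2 := pt_cs a (v + g • w)
  simp only [mink_sub_left, mink_sub_right, mink_add_left, mink_add_right, mink_smul_left,
    mink_smul_right, hw, hv, mink_comm v w, hg, mink_comm a.1 w, mink_comm b.1 v, ha, hb,
    mink_comm a.1 v, mink_comm b.1 a.1, a.2.1] at h1 h2
  have h3 := pt_neg a b
  nlinarith

lemma bddBelow_dist (A B : Set (Pt d)) : BddBelow {r | ∃ a ∈ A, ∃ b ∈ B, hdist a b = r} :=
  ⟨0, by rintro _ ⟨a, -, b, -, rfl⟩; exact hdist_nonneg a b⟩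

lemma dist_lower (w v : EE d) (hw : mink d w w = 1) (hv : mink d v v = 1)
    (g : ℝ) (hg : mink d w v = -g) (hg1 : 1 < g) (hA : (plane w).Nonempty)
    (hB : (plane v).Nonempty) : Real.arcosh g ≤ distSS (plane w) (plane v) := by
  obtain ⟨a, ha⟩ := hA
  obtain ⟨b, hb⟩ := hB
  refine le_csInf ⟨_, a, ha, b, hb, rfl⟩ ?_
  rintro _ ⟨a, ha, b, hb, rfl⟩
  rw [hdist_eq, Real.arcosh_le_arcosh (by linarith) (by linarith [one_le a b])]
  exact cosh_lower w v hw hv g hg a b ha hb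

lemma ultra (w v : EE d) (hw : mink d w w = 1) (hv : mink d v v = 1) (a : Pt d)
    (ha : a ∈ plane w) (hd : 0 < distSS (plane w) (plane v)) : 1 < mink d w v ^ 2 := by
  by_contra hc
  push Not at hc
  have ha : mink d w a.1 = 0 := ha
  set D := distSS (plane w) (plane v) with hD
  have hsD : 0 < Real.sinh D := Real.sinh_pos_iff.2 hd
  -- every point of `plane w` is far from `plane v`
  have key : ∀ b : Pt d, b ∈ plane w → Real.sinh D ^ 2 ≤ mink d v b.1 ^ 2 := by
    intro b hb
    set y := b.1 - mink d v b.1 • v with hy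
    have hyy : mink d y y = -(1 + mink d v b.1 ^ 2) := by
      simp only [hy, mink_sub_left, mink_sub_right, mink_smul_left, mink_smul_right, hv,
        mink_comm b.1 v, b.2.1]
      ring
    have hby : mink d b.1 y = -(1 + mink d v b.1 ^ 2) := by
      simp only [hy, mink_sub_right, mink_smul_right, mink_comm b.1 v, b.2.1]
      ring
    obtain ⟨q, hq⟩ := exists_pt b y (by rw [hyy]; nlinarith [sq_nonneg (mink d v b.1)])
      (by rw [hby]; nlinarith [sq_nonneg (mink d v b.1)])
    have hqv : q ∈ plane v := by
      show mink d v q.1 = 0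
      have h0 : mink d v y = 0 := by
        rw [hy, mink_sub_right, mink_smul_right, hv]; ring
      rw [hq, mink_smul_right, h0, mul_zero]
    have h1 : D ≤ hdist b q := csInf_le (bddBelow_dist _ _) ⟨b, hb, q, hqv, rfl⟩
    have h2 : Real.cosh D ≤ -mink d b.1 q.1 := by
      rw [← cosh_hdist, Real.cosh_le_cosh, abs_of_pos hd, abs_of_nonneg (hdist_nonneg _ _)]
      exact h1
    have h3 : (-mink d b.1 q.1) ^ 2 = 1 + mink d v b.1 ^ 2 := by
      have hp : 0 < 1 + mink d v b.1 ^ 2 := by positivity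
      rw [hq, mink_smul_right, hby, hyy, neg_neg]
      have := Real.sq_sqrt hp.le
      rw [mul_neg, neg_neg, mul_pow, inv_pow, this]
      field_simp
    have h4 := pow_le_pow_left₀ (Real.cosh_pos D).le h2 2
    rw [h3, Real.cosh_sq] at h4
    linarith
  set r := v - mink d w v • w with hr
  set ρ := 1 - mink d w v ^ 2 with hρ
  have hρ0 : 0 ≤ ρ := by linarith
  have hrr : mink d r r = ρ := by
    simp only [hr, mink_sub_left, mink_sub_right, mink_smul_left, mink_smul_right, hv, hw,
      mink_comm v w, hρ]
    ring
  have hwr : mink d w r = 0 := by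
    simp only [hr, mink_sub_right, mink_smul_right, hw]; ring
  have hvr : mink d v r = ρ := by
    simp only [hr, mink_sub_right, mink_smul_right, hv, mink_comm v w, hρ]; ring
  set α := mink d v a.1 with hα
  have har : mink d a.1 r = α := by
    simp only [hr, mink_sub_right, mink_smul_right, mink_comm a.1 v, mink_comm a.1 w, ha, hα]; ring
  have main : ∀ t : ℝ, 0 ≤ t → t * ρ ≤ 1 →
      Real.sinh D ^ 2 * (1 + 2 * t * α ^ 2 - t ^ 2 * α ^ 2 * ρ) ≤ α ^ 2 * (1 - t * ρ) ^ 2 := by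
    intro t ht htρ
    set y := a.1 - (t * α) • r with hy
    have hyy : mink d y y = -(1 + 2 * t * α ^ 2 - t ^ 2 * α ^ 2 * ρ) := by
      simp only [hy, mink_sub_left, mink_sub_right, mink_smul_left, mink_smul_right, hrr, a.2.1,
        mink_comm r a.1, har]
      ring
    have hneg : mink d y y < 0 := by
      rw [hyy]
      have : 0 ≤ t * α ^ 2 := by positivity
      nlinarith
    obtain ⟨q, c, hc1, hq⟩ := exists_pt' a y hneg
    have hqw : q ∈ plane w := by
      show mink d w q.1 = 0
      rw [hq, mink_smul_right, hy, mink_sub_right, mink_smul_right, hwr, ha]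
      ring
    have h1 := key q hqw
    have h2 : mink d v q.1 = c * (α * (1 - t * ρ)) := by
      rw [hq, mink_smul_right, hy, mink_sub_right, mink_smul_right, hvr]
      ring
    rw [h2] at h1
    rw [hyy, neg_neg] at hc1
    rw [hyy] at hneg
    have h5 := mul_le_mul_of_nonneg_right h1
      (a := 1 + 2 * t * α ^ 2 - t ^ 2 * α ^ 2 * ρ) (by linarith)
    refine h5.trans (le_of_eq ?_)
    linear_combination (α * (1 - t * ρ)) ^ 2 * hc1
  rcases hρ0.eq_or_lt with h0 | h0
  · have h1 := main (1 / (2 * Real.sinh D ^ 2)) (by positivity) (by rw [← h0]; simp)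
    rw [← h0] at h1
    have : Real.sinh D ^ 2 * (1 + 2 * (1 / (2 * Real.sinh D ^ 2)) * α ^ 2) =
      Real.sinh D ^ 2 + α ^ 2 := by field_simp
    have h2 : 0 < Real.sinh D ^ 2 := by positivity
    simp only [mul_zero, sub_zero, one_pow, mul_one] at h1
    linarith
  · have h1 := main (1 / ρ) (by positivity) (by field_simp; exact le_refl _)
    have e1 : 1 - 1 / ρ * ρ = 0 := by field_simp; ring
    have e2 : 1 + 2 * (1 / ρ) * α ^ 2 - (1 / ρ) ^ 2 * α ^ 2 * ρ = 1 + 1 / ρ * α ^ 2 := by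
      field_simp; ring
    rw [e1, e2] at h1
    have : 0 < Real.sinh D ^ 2 * (1 + 1 / ρ * α ^ 2) := by positivity
    simp at h1
    simp at this
    linarith

set_option maxHeartbeats 2000000 in
/-- Lemma 4: a farthest ultraparallel supporting hyperplane meets
the body in exactly one point. -/
theorem farthest_ultraparallel_support_singleton {d : ℕ} (C : Set (Pt d)) (hC : IsBody C)
    (H J : Set (Pt d)) (hH : Supports H C) (hJ : Supports J C)
    (hUP : Ultraparallel H J)
    (hmax : ∀ J', Supports J' C → Ultraparallel H J' → distSS H J' ≤ distSS H J) :
    ∃ p, J ∩ C = {p} := by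
  obtain ⟨w, hw, rfl, hwC⟩ := exists_normal C hC H hH
  obtain ⟨v, hv, rfl, hvC⟩ := exists_normal C hC J hJ
  obtain ⟨h0, hh0, hh0C⟩ := hH.2.1
  obtain ⟨x0, hx0, hx0C⟩ := hJ.2.1
  have hh0' : mink d w h0.1 = 0 := hh0
  have hx0' : mink d v x0.1 = 0 := hx0
  have hsq := ultra w v hw hv h0 hh0 hUP.2.2.2
  obtain ⟨g, hg⟩ : ∃ g, mink d w v = -g := ⟨-mink d w v, (neg_neg _).symm⟩
  rw [hg, neg_sq] at hsq
  -- the outward normals point away from each other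
  have hg1 : 1 < g := by
    by_contra hc
    have hgn : g < -1 := by
      by_contra hc2
      push Not at hc hc2
      nlinarith
    have hyy : mink d (v + g • w) (v + g • w) = 1 - g ^ 2 := by
      simp only [mink_add_left, mink_add_right, mink_smul_left, mink_smul_right, hv, hw,
        mink_comm v w, hg]
      ring
    have e1 : mink d h0.1 (v + g • w) = mink d v h0.1 := by
      rw [mink_add_right, mink_smul_right, mink_comm h0.1 v, mink_comm h0.1 w, hh0']; ring
    have e2 : mink d x0.1 (v + g • w) = g * mink d w x0.1 := by
      rw [mink_add_right, mink_smul_right, mink_comm x0.1 v, mink_comm x0.1 w, hx0']; ring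
    have hn : mink d (v + g • w) (v + g • w) < 0 := by rw [hyy]; linarith
    obtain ⟨q, hq⟩ := exists_pt h0 (v + g • w) hn (by rw [e1]; exact hvC h0 hh0C)
    have hqx := pt_neg x0 q
    rw [hq, mink_smul_right, e2] at hqx
    have hpos : 0 ≤ (Real.sqrt (-mink d (v + g • w) (v + g • w)))⁻¹ := by positivity
    have h3 : 0 ≤ g * mink d w x0.1 := by nlinarith [hwC x0 hx0C]
    nlinarith [mul_nonneg hpos h3]
  obtain ⟨s, hs0, hs2⟩ : ∃ s : ℝ, 0 < s ∧ s ^ 2 = g ^ 2 - 1 :=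
    ⟨Real.sqrt (g ^ 2 - 1), Real.sqrt_pos.2 (by linarith), Real.sq_sqrt (by linarith)⟩
  have hsqrt : Real.sqrt (g ^ 2 - 1) = s := by rw [← hs2]; exact Real.sqrt_sq hs0.le
  -- the foot `j` of the common perpendicular on `J`
  have hjj : mink d (w + g • v) (w + g • v) = -(g ^ 2 - 1) := by
    simp only [mink_add_left, mink_add_right, mink_smul_left, mink_smul_right, hv, hw,
      mink_comm v w, hg]
    ring
  obtain ⟨j, hj⟩ := exists_pt h0 (w + g • v) (by rw [hjj]; linarith) (by
    rw [mink_add_right, mink_smul_right, mink_comm h0.1 v, mink_comm h0.1 w, hh0']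
    nlinarith [hvC h0 hh0C])
  rw [hjj, neg_neg, hsqrt] at hj
  have hwj : mink d w j.1 = -s := by
    rw [hj, mink_smul_right, mink_add_right, mink_smul_right, hw, hg]
    field_simp
    linear_combination hs2
  have hvj : mink d v j.1 = 0 := by
    rw [hj, mink_smul_right, mink_add_right, mink_smul_right, hv, mink_comm v w, hg]
    ring
  -- the foot on `H`
  have hii : mink d (v + g • w) (v + g • w) = -(g ^ 2 - 1) := by
    simp only [mink_add_left, mink_add_right, mink_smul_left, mink_smul_right, hv, hw,
      mink_comm v w, hg]
    ring
  have hji : mink d j.1 (v + g • w) = -(g * s) := by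
    rw [mink_add_right, mink_smul_right, mink_comm j.1 v, mink_comm j.1 w, hvj, hwj]; ring
  obtain ⟨i, hi⟩ := exists_pt j (v + g • w) (by rw [hii]; linarith) (by
    rw [hji]; nlinarith [mul_pos (by linarith : (0 : ℝ) < g) hs0])
  rw [hii, neg_neg, hsqrt] at hi
  have hwi : mink d w i.1 = 0 := by
    rw [hi, mink_smul_right, mink_add_right, mink_smul_right, hw, hg]
    ring
  have hij : mink d i.1 j.1 = -g := by
    rw [mink_comm, hi, mink_smul_right, hji]
    field_simp
  have hup : distSS (plane w) (plane v) ≤ Real.arcosh g := by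
    refine csInf_le (bddBelow_dist _ _) ⟨i, hwi, j, hvj, ?_⟩
    rw [hdist_eq, hij, neg_neg]
  refine ⟨j, Set.eq_singleton_iff_nonempty_unique_mem.2 ⟨⟨x0, hx0, hx0C⟩, ?_⟩⟩
  rintro x ⟨hxv, hxC⟩
  have hxv : mink d v x.1 = 0 := hxv
  by_contra hne
  obtain ⟨k, hk⟩ : ∃ k, mink d j.1 x.1 = -k := ⟨-mink d j.1 x.1, (neg_neg _).symm⟩
  have hk1 : 1 < k := by
    by_contra hc
    exact hne (pt_eq_of j x (by rw [hk]; linarith)).symm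
  have hb : 0 < k ^ 2 - 1 := by nlinarith
  have hwx : mink d w x.1 = -(s * k) := by
    have h1 := hk
    rw [hj, mink_smul_left, mink_add_left, mink_smul_left, hxv] at h1
    field_simp at h1
    linarith
  have hg0 : 0 < g := by linarith
  have hk0 : 0 < k := by linarith
  -- the size of the perturbation
  obtain ⟨t, ht0, htk, htg⟩ : ∃ t : ℝ, 0 < t ∧ t * k < 1 ∧ t * k * g < 2 * s := by
    refine ⟨s / (k * g * (1 + s)), by positivity, ?_, ?_⟩
    · have e : s / (k * g * (1 + s)) * k = s / (g * (1 + s)) := by field_simp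
      rw [e, div_lt_one (by positivity)]
      nlinarith
    · have e : s / (k * g * (1 + s)) * k * g = s / (1 + s) := by field_simp
      rw [e, div_lt_iff₀ (by positivity)]
      nlinarith
  set z := x.1 - k • j.1 with hz
  have hzq : ∀ q : EE d, mink d z q = mink d x.1 q - k * mink d j.1 q := by
    intro q; rw [hz, mink_sub_left, mink_smul_left]
  have hcomp := body_compact C hC
  have hcont : ContinuousOn (fun q : EE d => (mink d v q + t * mink d z q) / (-mink d j.1 q))
      ((fun p : Pt d => p.1) '' C) := by
    refine ContinuousOn.div ?_ ?_ ?_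
    · exact ((mink_cont continuous_const continuous_id).add
        (continuous_const.mul (mink_cont continuous_const continuous_id))).continuousOn
    · exact (mink_cont continuous_const continuous_id).neg.continuousOn
    · rintro _ ⟨q, -, rfl⟩
      have := pt_neg j q
      simp only
      linarith
  obtain ⟨_, ⟨x1, hx1C, rfl⟩, hx1⟩ := hcomp.exists_isMaxOn ⟨_, x, hxC, rfl⟩ hcont
  obtain ⟨c, hc⟩ : ∃ c, (mink d v x1.1 + t * mink d z x1.1) / (-mink d j.1 x1.1) = c := ⟨_, rfl⟩
  have hmaxC : ∀ q ∈ C, mink d v q.1 + t * mink d z q.1 ≤ c * (-mink d j.1 q.1) := by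
    intro q hq
    have h1 := hx1 (Set.mem_image_of_mem (fun p : Pt d => p.1) hq)
    have h1 : (mink d v q.1 + t * mink d z q.1) / (-mink d j.1 q.1) ≤
      (mink d v x1.1 + t * mink d z x1.1) / (-mink d j.1 x1.1) := h1
    rw [hc, div_le_iff₀ (by linarith [pt_neg j q])] at h1
    exact h1
  have hjx1 := pt_neg j x1
  rw [div_eq_iff (by linarith)] at hc
  have hclow : t * (k ^ 2 - 1) ≤ c * k := by
    have h1 := hmaxC x hxC
    rw [hxv, hzq, x.2.1, hk] at h1
    linarith
  have hc0 : 0 < c := by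
    by_contra hcn
    push Not at hcn
    have h5 := mul_pos ht0 hb
    have h6 := mul_nonpos_of_nonpos_of_nonneg hcn hk0.le
    linarith
  have hcup : c ≤ t * k := by
    have h1 := hvC x1 hx1C
    have h2 := pt_neg x x1
    rw [hzq] at hc
    have h3 : c * (-mink d j.1 x1.1) ≤ t * k * (-mink d j.1 x1.1) := by
      have h4 := mul_neg_of_pos_of_neg ht0 h2
      rw [← hc, mul_sub]
      linarith
    exact le_of_mul_le_mul_right h3 (by linarith)
  set y := v + t • z + c • j.1 with hy
  have hyq : ∀ q : EE d, mink d y q = mink d v q + t * mink d z q + c * mink d j.1 q := by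
    intro q
    rw [hy, mink_add_left, mink_add_left, mink_smul_left, mink_smul_left]
  have hyy : mink d y y = 1 + t ^ 2 * (k ^ 2 - 1) - c ^ 2 := by
    simp only [hy, hz, mink_sub_left, mink_sub_right, mink_add_left, mink_add_right,
      mink_smul_left, mink_smul_right, hv, j.2.1, x.2.1, mink_comm x.1 j.1, mink_comm x.1 v,
      mink_comm j.1 v, hvj, hxv, hk]
    ring
  have hwy : mink d w y = -(g + c * s) := by
    simp only [hy, hz, mink_sub_right, mink_add_right, mink_smul_right, hg, hwj, hwx]
    ring
  have hN : 0 < mink d y y := by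
    rw [hyy]
    have : c ^ 2 < 1 := by nlinarith
    nlinarith [mul_pos (pow_pos ht0 2) hb]
  obtain ⟨r, hr0, hr2⟩ : ∃ r : ℝ, 0 < r ∧ r ^ 2 = mink d y y :=
    ⟨Real.sqrt (mink d y y), Real.sqrt_pos.2 hN, Real.sq_sqrt hN.le⟩
  have hnn : mink d (r⁻¹ • y) (r⁻¹ • y) = 1 := by
    rw [mink_smul_left, mink_smul_right, ← hr2]
    field_simp
  have hwn : mink d w (r⁻¹ • y) = -((g + c * s) / r) := by
    rw [mink_smul_right, hwy]
    field_simp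
  have hlt : g < (g + c * s) / r := by
    rw [lt_div_iff₀ hr0]
    apply lt_of_pow_lt_pow_left₀ 2 (by positivity)
    rw [mul_pow, hr2, hyy]
    have h1 : g * t ^ 2 * (k ^ 2 - 1) * k < 2 * s * c * k := by
      have h2 := mul_lt_mul_of_pos_right htg (mul_pos ht0 hb)
      have h3 := mul_le_mul_of_nonneg_left hclow (by positivity : (0 : ℝ) ≤ 2 * s)
      nlinarith
    have h2 : g * t ^ 2 * (k ^ 2 - 1) < 2 * s * c := lt_of_mul_lt_mul_right h1 hk0.le
    have h3 := mul_lt_mul_of_pos_left h2 hg0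
    nlinarith [sq_nonneg (g * c), sq_nonneg (c * s)]
  have hx1n : x1 ∈ plane (r⁻¹ • y) := by
    show mink d (r⁻¹ • y) x1.1 = 0
    rw [mink_smul_left, hyq, hc]
    ring
  have hsup : Supports (plane (r⁻¹ • y)) C := by
    refine ⟨⟨_, hnn, rfl⟩, ⟨x1, hx1n, hx1C⟩, not_intr C _ hnn ?_⟩
    intro q hq
    rw [mink_smul_left, hyq]
    have h1 := hmaxC q hq
    have h2 := inv_pos.2 hr0
    nlinarith
  have hlow := dist_lower w (r⁻¹ • y) hw hnn _ hwn (by linarith) ⟨h0, hh0⟩ ⟨x1, hx1n⟩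
  have hul : Ultraparallel (plane w) (plane (r⁻¹ • y)) := by
    refine ⟨⟨w, hw, rfl⟩, ⟨_, hnn, rfl⟩, ?_, lt_of_lt_of_le (Real.arcosh_pos (by linarith)) hlow⟩
    rw [Set.eq_empty_iff_forall_notMem]
    rintro q ⟨hq1, hq2⟩
    have := cosh_lower w (r⁻¹ • y) hw hnn _ hwn q q hq1 hq2
    rw [q.2.1] at this
    linarith
  have hfin := hmax _ hsup hul
  have hstrict := (Real.arcosh_lt_arcosh hg0 (by linarith)).2 hlt
  linarith

end HypSpace
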